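/- There is a universal constant C > 0 with the following property. Let n ≥ 2, let f : {0,1}^n → {0,1} be a total function that depends on each of its n variables, and suppose f is computed with bounded error by a strong probabilistic formula of size s. Then for every partition y_1,…,y_k of the variables of f into nonempty blocks, ∑_{i=1}^k D(f_i) ≤ C·√n·s. -/

import Mathlib

open scoped ENNReal

/-- A Boolean formula over variables `V`. -/
inductive BFormula (V : Type) : Type
  | var : V → BFormula V
  | const : Bool → BFormula V
  | node : (Bool → Bool → Bool) → BFormula V → BFormula V → BFormula V

namespace BFormula

/-- Evaluation of a formula on an assignment. -/
def eval {V : Type} (x : V → Bool) : BFormula V → Bool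
  | var v => x v
  | const b => b
  | node g l r => g (eval x l) (eval x r)

/-- Number of leaves labeled by a variable satisfying `P`. -/
def sizeP {V : Type} (P : V → Bool) : BFormula V → ℕ
  | var v => if P v then 1 else 0
  | const _ => 0
  | node _ l r => sizeP P l + sizeP P r

/-- Number of leaves labeled by variables. -/
def size {V : Type} (F : BFormula V) : ℕ := sizeP (fun _ => true) F

end BFormula

/-- Expected size of a strong probabilistic formula (distribution on formulas). -/
noncomputable def pmfSize {V : Type} (p : PMF (BFormula V)) : ℝ≥0∞ :=
  ∑' F, p F * (F.size : ℝ≥0∞)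

/-- A strong probabilistic formula computes `f` with bounded error (2/3). -/
def ComputesBdd {V : Type} (p : PMF (BFormula V)) (f : (V → Bool) → Bool) : Prop :=
  ∀ x : V → Bool, 2/3 ≤ ∑' F, (if F.eval x = f x then p F else 0)

/-- Alice's inputs in the `i`-th communication game: variables outside block `i`. -/
def AliceT {n k : ℕ} (y : Fin n → Fin k) (i : Fin k) : Type := {j : Fin n // y j ≠ i} → Bool
/-- Bob's inputs in the `i`-th communication game: variables in block `i`. -/
def BobT {n k : ℕ} (y : Fin n → Fin k) (i : Fin k) : Type := {j : Fin n // y j = i} → Bool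

/-- Combining Alice's and Bob's inputs to a full input. -/
def combine {n k : ℕ} (y : Fin n → Fin k) (i : Fin k)
    (a : AliceT y i) (b : BobT y i) : Fin n → Bool :=
  fun j => if h : y j = i then b ⟨j, h⟩ else a ⟨j, h⟩

/-- The `i`-th communication game induced by `f` and the partition `y`. -/
def game {n k : ℕ} (f : (Fin n → Bool) → Bool) (y : Fin n → Fin k) (i : Fin k) :
    AliceT y i → BobT y i → Bool :=
  fun a b => f (combine y i a b)

/-- Deterministic one-way communication complexity. -/
noncomputable def Dcc {A B : Type} (g : A → B → Bool) : ℕ :=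
  sInf {c : ℕ | ∃ M : A → Fin (2^c), ∃ o : Fin (2^c) → B → Bool, ∀ a b, o (M a) b = g a b}

/-- `S` is shattered by the rows of `g`. -/
def Shatters {A B : Type} (g : A → B → Bool) (S : Finset B) : Prop :=
  ∀ R ⊆ S, ∃ a : A, ∀ b ∈ S, (g a b = true ↔ b ∈ R)

/-- VC-dimension of the two-party problem `g`. -/
noncomputable def VCdim {A B : Type} (g : A → B → Bool) : ℕ :=
  sSup {d : ℕ | ∃ S : Finset B, Shatters g S ∧ S.card = d}

namespace BFormula

variable {V A B : Type}

lemma eval_congr_of_sizeP_eq_zero {P : V → Bool} {x x' : V → Bool}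
    (h : ∀ v, P v = false → x v = x' v) (F : BFormula V) (hF : F.sizeP P = 0) :
    F.eval x = F.eval x' := by
  induction F with
  | var v =>
    apply h
    simpa [sizeP] using hF
  | const b => rfl
  | node g l r hl hr =>
    simp only [sizeP, Nat.add_eq_zero_iff] at hF
    simp [eval, hl hF.1, hr hF.2]

/-- The subfunctions of `F` obtained by fixing the variables outside `P`, closed under unary
postcomposition, number at most `2` if no leaf is in `P`, and `16 ^ ℓ / 4` otherwise. -/
lemma exists_subfunctions_aux [Fintype B] (P : V → Bool) (c : A → B → V → Bool)
    (h₁ : ∀ v, P v = false → ∀ a b b', c a b v = c a b' v)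
    (h₂ : ∀ v, P v = true → ∀ a a' b, c a b v = c a' b v) (F : BFormula V) :
    ∃ T : Finset (B → Bool),
      (∀ (u : Bool → Bool) (a : A), (fun b => u (F.eval (c a b))) ∈ T) ∧
      (F.sizeP P = 0 → T.card ≤ 2) ∧ (F.sizeP P ≠ 0 → 4 * T.card ≤ 16 ^ F.sizeP P) := by
  classical
  have const_case : ∀ F : BFormula V, F.sizeP P = 0 → ∃ T : Finset (B → Bool),
      (∀ (u : Bool → Bool) (a : A), (fun b => u (F.eval (c a b))) ∈ T) ∧
      (F.sizeP P = 0 → T.card ≤ 2) ∧ (F.sizeP P ≠ 0 → 4 * T.card ≤ 16 ^ F.sizeP P) := by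
    intro F hF
    refine ⟨Finset.univ.image fun (t : Bool) (_ : B) => t, ?_, ?_, fun h => absurd hF h⟩
    · intro u a
      rcases isEmpty_or_nonempty B with hB | ⟨⟨b₀⟩⟩
      · exact Finset.mem_image.2 ⟨true, Finset.mem_univ _, funext fun b => hB.elim b⟩
      · refine Finset.mem_image.2 ⟨u (F.eval (c a b₀)), Finset.mem_univ _, funext fun b => ?_⟩
        rw [eval_congr_of_sizeP_eq_zero (fun v hv => h₁ v hv a b₀ b) F hF]
    · intro _
      exact Finset.card_image_le.trans (by simp)
  induction F with
  | var v =>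
    by_cases hv : P v = true
    · rcases isEmpty_or_nonempty A with hA | ⟨⟨a₀⟩⟩
      · exact ⟨∅, fun _ a => hA.elim a, by simp, by simp⟩
      · refine ⟨Finset.univ.image fun (u : Bool → Bool) (b : B) => u (c a₀ b v), ?_, ?_, ?_⟩
        · intro u a
          refine Finset.mem_image.2 ⟨u, Finset.mem_univ _, funext fun b => ?_⟩
          rw [h₂ v hv a₀ a b]; rfl
        · simp [sizeP, hv]
        · intro _
          have := Finset.card_image_le (s := (Finset.univ : Finset (Bool → Bool)))
            (f := fun (u : Bool → Bool) (b : B) => u (c a₀ b v))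
          simp only [Finset.card_univ, Fintype.card_fun, Fintype.card_bool] at this
          simp only [sizeP, hv, if_true]
          omega
    · exact const_case _ (by simp [sizeP, hv])
  | const b => exact const_case _ rfl
  | node g l r hl hr =>
    obtain ⟨Tl, hTl, hl₀, hl₁⟩ := hl
    obtain ⟨Tr, hTr, hr₀, hr₁⟩ := hr
    by_cases hl' : l.sizeP P = 0
    · refine ⟨Tr, ?_, by simpa [sizeP, hl'] using hr₀, by simpa [sizeP, hl'] using hr₁⟩
      intro u a
      rcases isEmpty_or_nonempty B with hB | ⟨⟨b₀⟩⟩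
      · convert hTr u a using 1
      · convert hTr (fun t => u (g (l.eval (c a b₀)) t)) a using 1
        funext b
        rw [eval_congr_of_sizeP_eq_zero (fun v hv => h₁ v hv a b₀ b) l hl']
        rfl
    by_cases hr' : r.sizeP P = 0
    · refine ⟨Tl, ?_, by simpa [sizeP, hr'] using hl₀, by simpa [sizeP, hr'] using hl₁⟩
      intro u a
      rcases isEmpty_or_nonempty B with hB | ⟨⟨b₀⟩⟩
      · convert hTl u a using 1
      · convert hTl (fun t => u (g t (r.eval (c a b₀)))) a using 1
        funext b
        rw [eval_congr_of_sizeP_eq_zero (fun v hv => h₁ v hv a b₀ b) r hr']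
        rfl
    refine ⟨(Finset.univ ×ˢ (Tl ×ˢ Tr)).image
      fun (q : (Bool → Bool) × (B → Bool) × (B → Bool)) b => q.1 (g (q.2.1 b) (q.2.2 b)),
      ?_, ?_, ?_⟩
    · intro u a
      exact Finset.mem_image.2 ⟨(u, fun b => l.eval (c a b), fun b => r.eval (c a b)),
        by simpa using ⟨hTl id a, hTr id a⟩, rfl⟩
    · simp [sizeP, hl']
    · intro _
      calc 4 * _ ≤ 4 * (4 * (Tl.card * Tr.card)) := by
            gcongr
            refine Finset.card_image_le.trans ?_
            simp [Finset.card_product]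
        _ = (4 * Tl.card) * (4 * Tr.card) := by ring
        _ ≤ 16 ^ l.sizeP P * 16 ^ r.sizeP P := Nat.mul_le_mul (hl₁ hl') (hr₁ hr')
        _ = _ := by rw [← pow_add]; rfl

lemma exists_subfunctions [Fintype B] (P : V → Bool) (c : A → B → V → Bool)
    (h₁ : ∀ v, P v = false → ∀ a b b', c a b v = c a b' v)
    (h₂ : ∀ v, P v = true → ∀ a a' b, c a b v = c a' b v) (F : BFormula V) :
    ∃ T : Finset (B → Bool), (∀ a : A, (fun b => F.eval (c a b)) ∈ T) ∧
      T.card ≤ 2 ^ (4 * F.sizeP P + 1) := by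
  obtain ⟨T, hT, hT₀, hT₁⟩ := exists_subfunctions_aux P c h₁ h₂ F
  refine ⟨T, hT id, ?_⟩
  rw [pow_succ, pow_mul]
  norm_num
  by_cases h : F.sizeP P = 0
  · simpa [h] using hT₀ h
  · have := hT₁ h
    omega

lemma sum_sizeP {ι : Type} (s : Finset ι) (P : ι → V → Bool) (Q : V → Bool)
    (h : ∀ v, ∑ i ∈ s, (if P i v then 1 else 0) = if Q v then 1 else 0) (F : BFormula V) :
    ∑ i ∈ s, F.sizeP (P i) = F.sizeP Q := by
  induction F with
  | var v => exact h v
  | const b => simp [sizeP]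
  | node g l r hl hr => simp [sizeP, Finset.sum_add_distrib, hl, hr]

end BFormula

section

variable {A B : Type}

lemma Dcc_le_of_message {γ : Type} [Fintype γ] (g : A → B → Bool) (M : A → γ)
    (hM : ∀ a a', M a = M a' → g a = g a') {c : ℕ} (hc : Fintype.card γ ≤ 2 ^ c) :
    Dcc g ≤ c := by
  classical
  obtain ⟨e⟩ := Function.Embedding.nonempty_of_card_le (α := γ) (β := Fin (2 ^ c)) (by simpa using hc)
  refine Nat.sInf_le ⟨fun a => e (M a), fun m b => decide (∃ a, e (M a) = m ∧ g a b = true), ?_⟩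
  intro a b
  rw [Bool.eq_iff_iff, decide_eq_true_iff]
  constructor
  · rintro ⟨a', h, hg⟩
    rwa [← hM a' a (e.injective h)]
  · exact fun h => ⟨a, rfl, h⟩

lemma sum_choose_le_pow (M d : ℕ) : ∑ k ∈ Finset.Iic d, M.choose k ≤ (M + 1) ^ d := by
  rw [add_pow, ← Nat.range_succ_eq_Iic]
  refine Finset.sum_le_sum fun k hk => ?_
  calc M.choose k ≤ M ^ k := Nat.choose_le_pow _ _
    _ ≤ M ^ k * 1 ^ (d - k) * d.choose k := by
      rw [one_pow, mul_one]
      exact Nat.le_mul_of_pos_right _ (Nat.choose_pos (by simpa [Nat.lt_succ_iff] using hk))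

/-- Sauer–Shelah bound on one-way communication. -/
lemma Dcc_le_of_shatters_card_le [Fintype B] (g : A → B → Bool) {m d : ℕ}
    (hm : Fintype.card B = 2 ^ m) (hd : ∀ S : Finset B, Shatters g S → S.card ≤ d) :
    Dcc g ≤ (m + 1) * d := by
  classical
  let row : A → Finset B := fun a => Finset.univ.filter fun b => g a b = true
  let 𝒜 : Finset (Finset B) := Finset.univ.filter fun s => ∃ a, row a = s
  have hrow : ∀ a, row a ∈ 𝒜 := fun a => by simp [𝒜]
  have hvc : 𝒜.vcDim ≤ d := by
    refine Finset.sup_le fun S hS => hd S fun R hR => ?_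
    obtain ⟨u, hu, hSu⟩ := (Finset.mem_shatterer.1 hS) hR
    obtain ⟨a, rfl⟩ : ∃ a, row a = u := by simpa [𝒜] using hu
    refine ⟨a, fun b hb => ?_⟩
    rw [← hSu]
    simp [row, hb]
  refine Dcc_le_of_message (γ := 𝒜) g (fun a => ⟨row a, hrow a⟩) ?_ ?_
  · intro a a' h
    funext b
    have h' : row a = row a' := congrArg Subtype.val h
    have : b ∈ row a ↔ b ∈ row a' := by rw [h']
    rw [Bool.eq_iff_iff]
    simpa [row] using this
  · rw [Fintype.card_coe]
    calc 𝒜.card ≤ 𝒜.shatterer.card := 𝒜.card_le_card_shatterer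
      _ ≤ ∑ k ∈ Finset.Iic 𝒜.vcDim, (Fintype.card B).choose k :=
        Finset.card_shatterer_le_sum_vcDim
      _ ≤ (2 ^ m + 1) ^ 𝒜.vcDim := by rw [hm]; exact sum_choose_le_pow _ _
      _ ≤ (2 ^ m + 1) ^ d := Nat.pow_le_pow_right (by positivity) hvc
      _ ≤ (2 ^ (m + 1)) ^ d := by
        gcongr
        have := Nat.one_le_two_pow (n := m)
        rw [pow_succ]; omega
      _ = 2 ^ ((m + 1) * d) := by rw [pow_mul]

lemma sum_two_pow_agreement [DecidableEq B] (S : Finset B) (h : B → Bool) :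
    ∑ R ∈ S.powerset, 2 ^ (S.filter fun b => h b = decide (b ∈ R)).card = 3 ^ S.card := by
  induction S using Finset.induction_on with
  | empty => simp
  | insert x S hx ih =>
    rw [Finset.sum_powerset_insert hx, Finset.card_insert_of_notMem hx, pow_succ, ← ih,
      Finset.sum_mul, ← Finset.sum_add_distrib]
    refine Finset.sum_congr rfl fun R hR => ?_
    have hxR : x ∉ R := fun h => hx (Finset.mem_powerset.1 hR h)
    have h2 : (S.filter fun b => h b = decide (b ∈ insert x R)) =
        S.filter fun b => h b = decide (b ∈ R) := by
      refine Finset.filter_congr fun b hb => ?_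
      have : b ≠ x := fun h => hx (h ▸ hb)
      simp [this]
    rw [Finset.filter_insert, Finset.filter_insert, h2]
    cases hh : h x <;> simp [hxR, hx, pow_succ] <;> ring

/-- If one of few functions is chosen for each subset `R` of `S`, the average agreement with the
indicator of `R` is bounded away from `2 / 3` of `S`. -/
lemma sum_agreement_le [DecidableEq B] (S : Finset B) (T : Finset (B → Bool)) {e : ℕ}
    (hT : T.card ≤ 2 ^ e) (h : Finset B → B → Bool) (hh : ∀ R, h R ∈ T) :
    5 * ∑ R ∈ S.powerset, (S.filter fun b => h R b = decide (b ∈ R)).card ≤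
      2 ^ S.card * (5 * e + 9 + 3 * S.card) := by
  set d := S.card with hd
  set t := e + (3 * d + 4) / 5 with ht
  let N : Finset B → ℕ := fun R => (S.filter fun b => h R b = decide (b ∈ R)).card
  have tangent : ∀ R, 2 ^ t * N R ≤ 2 ^ t * t + 2 ^ N R := by
    intro R
    rcases le_total (N R) t with hle | hle
    · exact (Nat.mul_le_mul_left _ hle).trans (Nat.le_add_right _ _)
    · obtain ⟨j, hj⟩ := Nat.exists_eq_add_of_le hle
      rw [hj, mul_add, pow_add 2 t j]
      exact Nat.add_le_add_left (Nat.mul_le_mul_left _ Nat.lt_two_pow_self.le) _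
  have exp_sum : ∑ R ∈ S.powerset, 2 ^ N R ≤ 2 ^ e * 3 ^ d := by
    calc ∑ R ∈ S.powerset, 2 ^ N R
        ≤ ∑ R ∈ S.powerset, ∑ f ∈ T, 2 ^ (S.filter fun b => f b = decide (b ∈ R)).card :=
          Finset.sum_le_sum fun R _ => Finset.single_le_sum
            (f := fun f : B → Bool => 2 ^ (S.filter fun b => f b = decide (b ∈ R)).card)
            (fun _ _ => Nat.zero_le _) (hh R)
      _ = T.card * 3 ^ d := by
          rw [Finset.sum_comm]
          simp [sum_two_pow_agreement, hd]
      _ ≤ _ := by gcongr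
  have three_pow : 3 ^ d ≤ 2 ^ ((3 * d + 4) / 5) * 2 ^ d := by
    rw [← pow_add]
    refine (Nat.pow_le_pow_iff_left (n := 5) (by norm_num)).1 ?_
    rw [← pow_mul, ← pow_mul]
    calc 3 ^ (d * 5) = (3 ^ 5) ^ d := by rw [← pow_mul, mul_comm]
      _ ≤ (2 ^ 8) ^ d := Nat.pow_le_pow_left (by norm_num) d
      _ = 2 ^ (8 * d) := by rw [← pow_mul]
      _ ≤ _ := Nat.pow_le_pow_right (by norm_num) (by omega)
  have total : 2 ^ t * ∑ R ∈ S.powerset, N R ≤ 2 ^ t * (2 ^ d * (t + 1)) := by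
    calc 2 ^ t * ∑ R ∈ S.powerset, N R = ∑ R ∈ S.powerset, 2 ^ t * N R := Finset.mul_sum _ _ _
      _ ≤ ∑ R ∈ S.powerset, (2 ^ t * t + 2 ^ N R) := Finset.sum_le_sum fun R _ => tangent R
      _ = 2 ^ d * (2 ^ t * t) + ∑ R ∈ S.powerset, 2 ^ N R := by
          rw [Finset.sum_add_distrib]; simp [hd]
      _ ≤ 2 ^ d * (2 ^ t * t) + 2 ^ e * (2 ^ ((3 * d + 4) / 5) * 2 ^ d) := by
          gcongr; exact exp_sum.trans (by gcongr)
      _ = _ := by rw [ht, pow_add]; ring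
  have := Nat.le_of_mul_le_mul_left total (by positivity)
  calc 5 * ∑ R ∈ S.powerset, N R ≤ 5 * (2 ^ d * (t + 1)) := by gcongr
    _ = 2 ^ d * (5 * (t + 1)) := by ring
    _ ≤ _ := by gcongr; omega

end

/-- Expected number of leaves labeled by a variable satisfying `P`. -/
noncomputable def pmfSizeP {V : Type} (p : PMF (BFormula V)) (P : V → Bool) : ℝ≥0∞ :=
  ∑' F, p F * (F.sizeP P : ℝ≥0∞)

lemma sum_pmfSizeP {V ι : Type} (p : PMF (BFormula V)) (s : Finset ι) (P : ι → V → Bool)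
    (Q : V → Bool)
    (h : ∀ v, ∑ i ∈ s, (if P i v then 1 else 0) = if Q v then 1 else 0) :
    ∑ i ∈ s, pmfSizeP p (P i) = pmfSizeP p Q := by
  unfold pmfSizeP
  rw [← Summable.tsum_finsetSum fun _ _ => ENNReal.summable]
  refine tsum_congr fun F => ?_
  rw [← Finset.mul_sum, ← BFormula.sum_sizeP s P Q h F, Nat.cast_sum]

lemma one_le_three_mul_pmfSizeP {V : Type} [DecidableEq V] {p : PMF (BFormula V)}
    {f : (V → Bool) → Bool} (hp : ComputesBdd p f) (j : V)
    (hj : ∃ x, f (Function.update x j true) ≠ f (Function.update x j false)) :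
    1 ≤ 3 * pmfSizeP p (fun v => decide (v = j)) := by
  obtain ⟨x, hx⟩ := hj
  have key := add_le_add (hp (Function.update x j true)) (hp (Function.update x j false))
  rw [← ENNReal.tsum_add] at key
  have bound : (2 / 3 + 2 / 3 : ℝ≥0∞) ≤ 1 + pmfSizeP p (fun v => decide (v = j)) := by
    refine key.trans ?_
    rw [← p.tsum_coe, pmfSizeP, ← ENNReal.tsum_add]
    refine ENNReal.tsum_le_tsum fun F => ?_
    by_cases hF : F.sizeP (fun v => decide (v = j)) = 0
    · have : F.eval (Function.update x j true) = F.eval (Function.update x j false) :=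
        BFormula.eval_congr_of_sizeP_eq_zero (fun v hv => by
          have : v ≠ j := by simpa using hv
          simp [this]) F hF
      rw [this]
      split_ifs with h₁ h₂
      · exact absurd (h₁.symm.trans h₂) hx
      all_goals simp
    · have h1 : (1 : ℝ≥0∞) ≤ (F.sizeP (fun v => decide (v = j)) : ℝ≥0∞) := by
        exact_mod_cast Nat.one_le_iff_ne_zero.2 hF
      refine add_le_add (by split_ifs <;> simp) ?_
      calc (if _ then p F else 0) ≤ p F * 1 := by split_ifs <;> simp
        _ ≤ _ := by gcongr
  by_cases htop : pmfSizeP p (fun v => decide (v = j)) = ⊤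
  · simp [htop]
  lift pmfSizeP p (fun v => decide (v = j)) to NNReal using htop with z
  have b' : (2 / 3 + 2 / 3 : NNReal) ≤ 1 + z := by
    have e : ((2 / 3 + 2 / 3 : NNReal) : ℝ≥0∞) = 2 / 3 + 2 / 3 := by
      push_cast [ENNReal.coe_div]; rfl
    rw [← e] at bound
    exact_mod_cast bound
  have b'' : (2 / 3 + 2 / 3 : ℝ) ≤ 1 + z := by exact_mod_cast b'
  have : (1 : ℝ) ≤ 3 * z := by linarith
  exact_mod_cast this

lemma card_le_of_shatters {V A B : Type} [Fintype B] {p : PMF (BFormula V)}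
    {f : (V → Bool) → Bool} (hp : ComputesBdd p f) (P : V → Bool) (c : A → B → V → Bool)
    (h₁ : ∀ v, P v = false → ∀ a b b', c a b v = c a b' v)
    (h₂ : ∀ v, P v = true → ∀ a a' b, c a b v = c a' b v)
    (S : Finset B) (hS : Shatters (fun a b => f (c a b)) S) (hfin : pmfSizeP p P ≠ ⊤) :
    (S.card : ℝ) ≤ 60 * (pmfSizeP p P).toReal + 42 := by
  classical
  have hS' : ∀ R : Finset B, ∃ a, R ⊆ S → ∀ b ∈ S, f (c a b) = decide (b ∈ R) := by
    intro R
    by_cases hR : R ⊆ S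
    · obtain ⟨a, ha⟩ := hS R hR
      exact ⟨a, fun _ b hb => by rw [Bool.eq_iff_iff, decide_eq_true_iff]; exact ha b hb⟩
    · obtain ⟨a, -⟩ := hS ∅ (Finset.empty_subset _)
      exact ⟨a, fun h => absurd h hR⟩
  choose a ha using hS'
  have agree : ∀ F : BFormula V,
      5 * ∑ R ∈ S.powerset, ∑ b ∈ S, (if F.eval (c (a R) b) = f (c (a R) b) then 1 else 0) ≤
        2 ^ S.card * (20 * F.sizeP P + 14 + 3 * S.card) := by
    intro F
    obtain ⟨T, hT, hcard⟩ := BFormula.exists_subfunctions P c h₁ h₂ F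
    have := sum_agreement_le S T hcard (fun R b => F.eval (c (a R) b)) (fun R => hT (a R))
    calc _ = 5 * ∑ R ∈ S.powerset,
          (S.filter fun b => F.eval (c (a R) b) = decide (b ∈ R)).card := by
          congr 1
          refine Finset.sum_congr rfl fun R hR => ?_
          rw [Finset.card_filter]
          refine Finset.sum_congr rfl fun b hb => ?_
          rw [ha R (Finset.mem_powerset.1 hR) b hb]
      _ ≤ _ := this
      _ = _ := by ring
  have main : 5 * ((2 : ℝ≥0∞) ^ S.card * (S.card * (2 / 3))) ≤
      2 ^ S.card * (20 * pmfSizeP p P + (14 + 3 * S.card)) := by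
    calc 5 * ((2 : ℝ≥0∞) ^ S.card * (S.card * (2 / 3)))
        = 5 * ∑ R ∈ S.powerset, ∑ b ∈ S, (2 / 3 : ℝ≥0∞) := by simp
      _ ≤ 5 * ∑ R ∈ S.powerset, ∑ b ∈ S,
          ∑' F : BFormula V, (if F.eval (c (a R) b) = f (c (a R) b) then p F else 0) := by
          gcongr with R _ b _
          exact hp _
      _ = ∑' F : BFormula V, p F * ((5 * ∑ R ∈ S.powerset, ∑ b ∈ S,
          (if F.eval (c (a R) b) = f (c (a R) b) then 1 else 0) : ℕ) : ℝ≥0∞) := by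
          simp_rw [← Summable.tsum_finsetSum fun _ _ => ENNReal.summable]
          rw [← ENNReal.tsum_mul_left]
          refine tsum_congr fun F => ?_
          push_cast
          simp only [Finset.mul_sum, mul_ite, mul_one, mul_zero]
          refine Finset.sum_congr rfl fun R _ => Finset.sum_congr rfl fun b _ => ?_
          split_ifs
          · rw [mul_comm]
          · rfl
      _ ≤ ∑' F : BFormula V,
          p F * ((2 ^ S.card * (20 * F.sizeP P + 14 + 3 * S.card) : ℕ) : ℝ≥0∞) := by
          exact ENNReal.tsum_le_tsum fun F => mul_le_mul_right (Nat.cast_le.2 (agree F)) _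
      _ = ∑' F : BFormula V, 2 ^ S.card * (20 * (p F * (F.sizeP P : ℝ≥0∞)) +
            p F * (14 + 3 * S.card)) := by
          refine tsum_congr fun F => ?_
          push_cast
          ring
      _ = _ := by
          rw [ENNReal.tsum_mul_left, ENNReal.tsum_add, ENNReal.tsum_mul_left,
            ENNReal.tsum_mul_right, p.tsum_coe, one_mul, pmfSizeP]
  lift pmfSizeP p P to NNReal using hfin with z
  have e : ((5 * (2 ^ S.card * (S.card * (2 / 3))) : NNReal) : ℝ≥0∞) =
      5 * ((2 : ℝ≥0∞) ^ S.card * (S.card * (2 / 3))) := by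
    push_cast [ENNReal.coe_div]; rfl
  rw [← e] at main
  have main' : (5 * (2 ^ S.card * (S.card * (2 / 3))) : NNReal) ≤
      2 ^ S.card * (20 * z + (14 + 3 * S.card)) := by exact_mod_cast main
  have main'' : (5 * (2 ^ S.card * (S.card * (2 / 3))) : ℝ) ≤
      2 ^ S.card * (20 * z + (14 + 3 * S.card)) := by exact_mod_cast main'
  have h3 : (2 : ℝ) ^ S.card * (10 / 3 * S.card) ≤
      2 ^ S.card * (20 * z + (14 + 3 * S.card)) := by linarith
  have h4 := le_of_mul_le_mul_left h3 (by positivity)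
  simp only [ENNReal.coe_toReal]
  linarith

/-- The contribution of a single block to the Nechiporuk function. -/
lemma Dcc_game_le {n k : ℕ} {f : (Fin n → Bool) → Bool}
    (hf : ∀ i : Fin n, ∃ x : Fin n → Bool,
      f (Function.update x i true) ≠ f (Function.update x i false))
    {p : PMF (BFormula (Fin n))} (hp : ComputesBdd p f) {y : Fin n → Fin k} {i : Fin k}
    (hi : ∃ j, y j = i) (hfin : pmfSizeP p (fun j => decide (y j = i)) ≠ ⊤) :
    (Dcc (game f y i) : ℝ) ≤
      34 * Real.sqrt n * (pmfSizeP p (fun j => decide (y j = i))).toReal := by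
  classical
  let _ : Fintype (BobT y i) := inferInstanceAs (Fintype ({j : Fin n // y j = i} → Bool))
  let _ : Fintype (AliceT y i) := inferInstanceAs (Fintype ({j : Fin n // y j ≠ i} → Bool))
  set P : Fin n → Bool := fun j => decide (y j = i) with hP
  set m := Fintype.card {j : Fin n // y j = i} with hm
  have hm1 : 1 ≤ m := by
    obtain ⟨j, hj⟩ := hi
    exact Fintype.card_pos_iff.2 ⟨⟨j, hj⟩⟩
  have hcardB : Fintype.card (BobT y i) = 2 ^ m := by
    change Fintype.card ({j : Fin n // y j = i} → Bool) = 2 ^ m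
    simp only [Fintype.card_fun, Fintype.card_bool, hm]
  have hcardA : Fintype.card (AliceT y i) ≤ 2 ^ n := by
    change Fintype.card ({j : Fin n // y j ≠ i} → Bool) ≤ 2 ^ n
    rw [Fintype.card_fun, Fintype.card_bool]
    refine Nat.pow_le_pow_right (by norm_num) ?_
    exact (Fintype.card_subtype_le fun j : Fin n => y j ≠ i).trans (by simp)
  have hmle : (m : ℝ) ≤ 3 * (pmfSizeP p P).toReal := by
    have hsum : ∑ j ∈ Finset.univ.filter (fun j => y j = i),
        pmfSizeP p (fun v => decide (v = j)) = pmfSizeP p P := by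
      refine sum_pmfSizeP p _ _ _ fun v => ?_
      simp [hP]
    have : (m : ℝ≥0∞) ≤ 3 * pmfSizeP p P := by
      rw [← hsum, Finset.mul_sum, hm, Fintype.card_subtype]
      calc _ = ∑ j ∈ Finset.univ.filter (fun j => y j = i), (1 : ℝ≥0∞) := by simp
        _ ≤ _ := Finset.sum_le_sum fun j _ => one_le_three_mul_pmfSizeP hp j (hf j)
    have := ENNReal.toReal_mono (ENNReal.mul_ne_top (by norm_num) hfin) this
    simpa using this
  set σ := (pmfSizeP p P).toReal with hσ
  have hD₁ : Dcc (game f y i) ≤ n :=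
    Dcc_le_of_message _ id (fun a a' h => by rw [show a = a' from h]) hcardA
  have hm1' : (1 : ℝ) ≤ m := by exact_mod_cast hm1
  have hσ0 : 0 ≤ σ := by linarith
  have hD₂ : Dcc (game f y i) ≤ (m + 1) * ⌊60 * σ + 42⌋₊ := by
    refine Dcc_le_of_shatters_card_le _ hcardB fun S hS => Nat.le_floor ?_
    refine card_le_of_shatters hp P (combine y i) ?_ ?_ S hS hfin
    · intro v hv a b b'
      have : ¬ y v = i := by simpa [hP] using hv
      simp [combine, this]
    · intro v hv a a' b
      have : y v = i := by simpa [hP] using hv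
      simp [combine, this]
  set D : ℝ := (Dcc (game f y i) : ℝ) with hD
  have hD0 : 0 ≤ D := Nat.cast_nonneg _
  have hD₁' : D ≤ n := Nat.cast_le.2 hD₁
  have hD₂' : D ≤ 6 * σ * (186 * σ) := by
    calc D ≤ (m + 1) * (⌊60 * σ + 42⌋₊ : ℝ) := by
          rw [hD]
          exact_mod_cast hD₂
      _ ≤ (6 * σ) * (186 * σ) := by
        gcongr
        · linarith
        · exact (Nat.floor_le (by positivity)).trans (by linarith)
  refine (pow_le_pow_iff_left₀ hD0 (by positivity) two_ne_zero).1 ?_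
  rw [mul_pow, mul_pow, Real.sq_sqrt (Nat.cast_nonneg _)]
  calc D ^ 2 = D * D := sq D
    _ ≤ n * (6 * σ * (186 * σ)) := by gcongr
    _ = 1116 * (n * σ ^ 2) := by ring
    _ ≤ 1156 * (n * σ ^ 2) := by gcongr; norm_num
    _ = _ := by ring

/-- If a total function `f` of `n` variables depending on all of them is computed
with bounded error by a strong probabilistic formula of size `s`, then for every
partition of the variables into nonempty blocks the Ne\v ciporuk function
`∑ D(f_i)` is at most `C·√n·s`. -/
theorem stmt4 :
    ∃ C : ℝ, 0 < C ∧
      ∀ (n : ℕ), 2 ≤ n →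
        ∀ f : (Fin n → Bool) → Bool,
          (∀ i : Fin n, ∃ x : Fin n → Bool,
            f (Function.update x i true) ≠ f (Function.update x i false)) →
          ∀ p : PMF (BFormula (Fin n)), ComputesBdd p f →
            ∀ (k : ℕ) (y : Fin n → Fin k), Function.Surjective y →
              (∑ i : Fin k, (Dcc (game f y i) : ℝ≥0∞)) ≤
                ENNReal.ofReal (C * Real.sqrt n) * pmfSize p := by
  refine ⟨34, by norm_num, fun n hn f hf p hp k y hy => ?_⟩
  have hpos : (0 : ℝ) < Real.sqrt n := Real.sqrt_pos.2 (by exact_mod_cast (by omega : 0 < n))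
  have hsum : ∑ i : Fin k, pmfSizeP p (fun j => decide (y j = i)) = pmfSize p := by
    refine sum_pmfSizeP p _ _ _ fun v => ?_
    simp
  by_cases htop : pmfSize p = ⊤
  · rw [htop, ENNReal.mul_top (by simpa using hpos)]
    exact le_top
  have hfin : ∀ i, pmfSizeP p (fun j => decide (y j = i)) ≠ ⊤ := by
    intro i h
    refine htop (hsum ▸ ENNReal.sum_eq_top.2 ⟨i, Finset.mem_univ _, h⟩)
  rw [← hsum, Finset.mul_sum]
  refine Finset.sum_le_sum fun i _ => ?_
  rw [← ENNReal.ofReal_toReal (hfin i), ← ENNReal.ofReal_mul (by positivity),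
    ← ENNReal.ofReal_natCast]
  exact ENNReal.ofReal_le_ofReal (Dcc_game_le hf hp (hy i) (hfin i))
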